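/- Let k be an infinite field and Γ a finite graph. The invariant subring R := A(Γ)^{T_Γ} is a reduced ring, its Krull dimension equals the first Betti number b₁(Γ), and the number of its minimal prime ideals equals the number of totally cyclic orientations of Γ∖E_sep. -/

import Mathlib

/-!
Serre-style finite graphs: a vertex type `V`, an oriented-edge type `E` with a
fixed-point-free involution `inv` (edge reversal) and source/target maps `s, t`
with `s (inv e) = t e`.  An unoriented edge is an `inv`-orbit `{e, inv e}`;
subsets of unoriented edges are encoded as `inv`-closed subsets of `E`, and an
orientation of a spanning subgraph `Γ∖T` is encoded by the set `O` of its
positively oriented edges.  1-chains with coefficients in `A` are encoded as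
functions `c : E → A` with `c (inv e) = - c e` (so that `(c, e⃗) = c e` for the
standard bilinear form).
-/

structure SerreGraph where
  V : Type
  E : Type
  [fintypeV : Fintype V]
  [fintypeE : Fintype E]
  [decEqV : DecidableEq V]
  [decEqE : DecidableEq E]
  inv : E → E
  s : E → V
  t : E → V
  inv_inv : ∀ e, inv (inv e) = e
  inv_ne : ∀ e, inv e ≠ e
  s_inv : ∀ e, s (inv e) = t e

attribute [instance] SerreGraph.fintypeV SerreGraph.fintypeE
attribute [instance] SerreGraph.decEqV SerreGraph.decEqE

namespace SerreGraph

variable (Γ : SerreGraph)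

/-- Reachability between vertices in the spanning subgraph whose allowed oriented
edges are those in `A`. -/
def Reach (A : Set Γ.E) : Γ.V → Γ.V → Prop :=
  Relation.ReflTransGen (fun a b => ∃ e ∈ A, Γ.s e = a ∧ Γ.t e = b)

/-- The number of connected components of the spanning subgraph with allowed
oriented edges `A`. -/
noncomputable def numComponents (A : Set Γ.E) : ℕ :=
  Nat.card (Quot (fun a b : Γ.V => ∃ e ∈ A, Γ.s e = a ∧ Γ.t e = b))

/-- The set of separating (oriented) edges: removing the underlying unoriented
edge increases the number of connected components. -/
def Esep : Set Γ.E :=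
  {e | Γ.numComponents Set.univ < Γ.numComponents {f | f ≠ e ∧ f ≠ Γ.inv e}}

/-- `T` encodes a set of unoriented edges. -/
def InvClosed (T : Set Γ.E) : Prop := ∀ e, e ∈ T ↔ Γ.inv e ∈ T

/-- `O` is (the set of positively oriented edges of) an orientation of `Γ∖T`. -/
def IsOrientation (T O : Set Γ.E) : Prop :=
  (∀ e ∈ O, e ∉ T) ∧ ∀ e, e ∉ T → (e ∈ O ↔ Γ.inv e ∉ O)

/-- A totally cyclic orientation of `Γ∖T`: an orientation such that there is no
vertex set `W` which is nonempty and proper inside some connected component of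
`Γ∖T` and such that all edges of `Γ∖T` crossing the boundary of `W` are oriented
out of `W` (this is the componentwise condition of the paper). -/
def IsTotallyCyclic (T O : Set Γ.E) : Prop :=
  Γ.IsOrientation T O ∧
    ¬ ∃ W : Set Γ.V, (∃ v ∈ W, ∃ w ∈ Wᶜ, Γ.Reach Tᶜ v w) ∧
        ∀ e ∈ O, Γ.t e ∈ W → Γ.s e ∈ W

/-- `γ` is (the set of positively oriented edges of) an oriented circuit of `Γ`:
a cyclic subgraph (connected, first Betti number one, no separating edges)
together with a totally cyclic orientation; equivalently a directed cycle:
each incident vertex has exactly one outgoing and one incoming edge in `γ`,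
and the support is connected. -/
def IsCircuit (γ : Finset Γ.E) : Prop :=
  γ.Nonempty ∧ (∀ e ∈ γ, Γ.inv e ∉ γ) ∧
    (∀ v ∈ γ.image Γ.s ∪ γ.image Γ.t, ∃! e, e ∈ γ ∧ Γ.s e = v) ∧
    (∀ v ∈ γ.image Γ.s ∪ γ.image Γ.t, ∃! e, e ∈ γ ∧ Γ.t e = v) ∧
    ∀ e ∈ γ, ∀ f ∈ γ, Γ.Reach ((↑γ : Set Γ.E) ∪ Γ.inv '' ↑γ) (Γ.s e) (Γ.s f)

/-- The class `[γ] ∈ H₁(Γ,ℤ)` of an oriented circuit. -/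
def circChainZ (γ : Finset Γ.E) : Γ.E → ℤ :=
  fun e => if e ∈ γ then 1 else if Γ.inv e ∈ γ then -1 else 0

/-- The class `[γ] ∈ H₁(Γ,ℝ)` of an oriented circuit. -/
noncomputable def circChainR (γ : Finset Γ.E) : Γ.E → ℝ :=
  fun e => (Γ.circChainZ γ e : ℝ)

/-- `Cir_φ(Γ∖T)`: oriented circuits of `Γ∖T` compatibly oriented with the
orientation with positive edges `O`. -/
def Cir (T O : Set Γ.E) : Set (Finset Γ.E) :=
  {γ | Γ.IsCircuit γ ∧ (∀ e ∈ γ, e ∈ O) ∧ ∀ e ∈ γ, e ∉ T}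

/-- `c` is a 1-cycle: a skew 1-chain with vanishing boundary, i.e. an element of
`H₁(Γ,A)`. -/
def IsCycle {A : Type*} [AddCommGroup A] (c : Γ.E → A) : Prop :=
  (∀ e, c (Γ.inv e) = - c e) ∧
    ∀ v, ∑ e ∈ Finset.univ.filter (fun e => Γ.t e = v), c e = 0

/-- An element of `H₁(Γ∖T, A) ⊆ H₁(Γ,A)`: a cycle supported on edges not in `T`. -/
def IsCycleOn {A : Type*} [AddCommGroup A] (T : Set Γ.E) (c : Γ.E → A) : Prop :=
  Γ.IsCycle c ∧ ∀ e ∈ T, c e = 0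

/-- The standard positive definite bilinear form on `C⃗₁(Γ,ℝ)`, for which
`(c, e⃗) = c e`. -/
noncomputable def pair (c c' : Γ.E → ℝ) : ℝ := (∑ e, c e * c' e) / 2

/-- The first Betti number `b₁(Γ) = dim_ℝ H₁(Γ,ℝ)`. -/
noncomputable def b1 : ℕ :=
  Module.finrank ℝ (Submodule.span ℝ {c : Γ.E → ℝ | Γ.IsCycle c})

/-- `b₁(Γ∖T) = dim_ℝ H₁(Γ∖T,ℝ)`. -/
noncomputable def b1Sub (T : Set Γ.E) : ℕ :=
  Module.finrank ℝ (Submodule.span ℝ {c : Γ.E → ℝ | Γ.IsCycleOn T c})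

/-- The cone `σ(T,φ) ⊆ H₁(Γ,ℝ)` of the cographic fan associated to a pair
`(T, O)` with `O` an orientation of `Γ∖T`. -/
def sigmaCone (T O : Set Γ.E) : Set (Γ.E → ℝ) :=
  {v | Γ.IsCycle v ∧ (∀ e ∈ O, 0 ≤ v e) ∧ ∀ e ∈ T, v e = 0}

/-- The poset `OP_Γ` of totally cyclic orientations: pairs `(T, O)` with `T` a
set of unoriented edges and `O` a totally cyclic orientation of `Γ∖T`. -/
def OP : Set (Set Γ.E × Set Γ.E) :=
  {p | Γ.InvClosed p.1 ∧ Γ.IsTotallyCyclic p.1 p.2}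

/-- The order on `OP_Γ`: `(T',φ') ≤ (T,φ)` iff `T' ⊇ T` and `φ'` is the
restriction of `φ`. -/
def OPle (p q : Set Γ.E × Set Γ.E) : Prop :=
  q.1 ⊆ p.1 ∧ p.2 = q.2 ∩ p.1ᶜ

/-- `H₁(Γ,ℤ)` viewed as the set of lattice points of `H₁(Γ,ℝ)`. -/
def H1Z : Set (Γ.E → ℝ) := {c | Γ.IsCycle c ∧ ∀ e, ∃ n : ℤ, c e = (n : ℝ)}

/-- The Voronoi polytope `Vor_Γ ⊆ H₁(Γ,ℝ)`. -/
def voronoi : Set (Γ.E → ℝ) :=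
  {v | Γ.IsCycle v ∧ ∀ l ∈ Γ.H1Z, Γ.pair v v ≤ Γ.pair (v - l) (v - l)}

/-- A (exposed) face of the Voronoi polytope. -/
def IsVorFace (F : Set (Γ.E → ℝ)) : Prop :=
  ∃ l : (Γ.E → ℝ) →ₗ[ℝ] ℝ, F = {v | v ∈ Γ.voronoi ∧ ∀ w ∈ Γ.voronoi, l w ≤ l v}

/-- The face `F(T,φ)` of the Voronoi polytope associated to `(T,O) ∈ OP_Γ`. -/
def vorFace (T O : Set Γ.E) : Set (Γ.E → ℝ) :=
  {v | v ∈ Γ.voronoi ∧ ∀ γ ∈ Γ.Cir T O,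
      Γ.pair v (Γ.circChainR γ) = Γ.pair (Γ.circChainR γ) (Γ.circChainR γ) / 2}

end SerreGraph

namespace SerreGraph

open MvPolynomial

variable (Γ : SerreGraph)

/-- The ideal `(U_{e⃗}·U_{ι(e⃗)} : e ∈ E)` of the polynomial ring `k[U_{e⃗}]`. -/
noncomputable def relIdeal (k : Type*) [CommRing k] : Ideal (MvPolynomial Γ.E k) :=
  Ideal.span {q | ∃ e : Γ.E, q = X e * X (Γ.inv e)}

/-- The ring `A(Γ) = k[U_{e⃗} : e⃗ ∈ E⃗]/(U_{e⃗}·U_{ι(e⃗)})`. -/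
abbrev Aring (k : Type*) [CommRing k] := MvPolynomial Γ.E k ⧸ Γ.relIdeal k

/-- The action of `λ ∈ T_Γ = (kˣ)^V` on `A(Γ)`, determined by
`U_{e⃗} ↦ λ_{s(e⃗)} λ_{t(e⃗)}⁻¹ U_{e⃗}`. -/
noncomputable def torusAct (k : Type*) [CommRing k] (lam : Γ.V → kˣ) :
    Γ.Aring k →ₐ[k] Γ.Aring k :=
  Ideal.Quotient.liftₐ (Γ.relIdeal k)
    ((Ideal.Quotient.mkₐ k (Γ.relIdeal k)).comp
      (MvPolynomial.aeval
        (fun e => C ((lam (Γ.s e) : k) * ((lam (Γ.t e))⁻¹ : kˣ)) * X e)))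
    (by
      intro a ha
      simp only [AlgHom.comp_apply, Ideal.Quotient.mkₐ_eq_mk]
      rw [Ideal.Quotient.eq_zero_iff_mem]
      have h : Γ.relIdeal k ≤
          Ideal.comap (MvPolynomial.aeval
            (fun e => C ((lam (Γ.s e) : k) * ((lam (Γ.t e))⁻¹ : kˣ)) * X e) :
              MvPolynomial Γ.E k →ₐ[k] MvPolynomial Γ.E k).toRingHom
            (Γ.relIdeal k) := by
        rw [relIdeal, Ideal.span_le]
        rintro q ⟨e, rfl⟩
        simp only [SetLike.mem_coe, Ideal.mem_comap, AlgHom.toRingHom_eq_coe,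
          RingHom.coe_coe, map_mul, aeval_X]
        have hmem : (X e * X (Γ.inv e) : MvPolynomial Γ.E k) ∈ Γ.relIdeal k :=
          Ideal.subset_span ⟨e, rfl⟩
        have h2 : (C ((lam (Γ.s e) : k)) * C (((lam (Γ.t e))⁻¹ : kˣ) : k) *
            (C ((lam (Γ.s (Γ.inv e)) : k)) * C (((lam (Γ.t (Γ.inv e)))⁻¹ : kˣ) : k))) *
            (X e * X (Γ.inv e)) ∈ Γ.relIdeal k :=
          Ideal.mul_mem_left _ _ hmem
        rw [relIdeal] at h2
        convert h2 using 1
        ring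
      exact h ha)

/-- The invariant subring `A(Γ)^{T_Γ}`. -/
noncomputable def invariants (k : Type*) [CommRing k] : Subalgebra k (Γ.Aring k) :=
  ⨅ lam : Γ.V → kˣ, AlgHom.equalizer (Γ.torusAct k lam) (AlgHom.id k (Γ.Aring k))

/-- The monomial `M^c = ∏ U_{e⃗}^{max(c(e⃗),0)} ∈ A(Γ)` attached to a skew chain
`c`, using its canonical nonnegative form. -/
noncomputable def Mon (k : Type*) [CommRing k] (c : Γ.E → ℤ) : Γ.Aring k :=
  Ideal.Quotient.mk (Γ.relIdeal k) (∏ e, X e ^ (c e).toNat)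

end SerreGraph



namespace SerreGraph

section Flows

variable {Γ : SerreGraph}

theorem t_inv (e : Γ.E) : Γ.t (Γ.inv e) = Γ.s e := by
  rw [← Γ.s_inv, Γ.inv_inv]

/-- The multiplicities `a` on oriented edges have equal inflow and outflow at every vertex. -/
def Balanced (a : Γ.E → ℕ) : Prop :=
  ∀ v, ∑ e with Γ.t e = v, a e = ∑ e with Γ.s e = v, a e

/-- `S` is the set of positively traversed edges of a real cycle. -/
def IsSupp (S : Set Γ.E) : Prop := ∃ c : Γ.E → ℝ, Γ.IsCycle c ∧ S = {e | 0 < c e}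

theorem IsSupp.inv_notMem {S : Set Γ.E} (hS : IsSupp S) {e : Γ.E} (he : e ∈ S) :
    Γ.inv e ∉ S := by
  obtain ⟨c, hc, rfl⟩ := hS
  simp only [Set.mem_ofPred_eq, hc.1 e] at *
  linarith

theorem isCycle_zero : Γ.IsCycle (0 : Γ.E → ℝ) := by
  constructor <;> simp

theorem IsCycle.add {c d : Γ.E → ℝ} (hc : Γ.IsCycle c) (hd : Γ.IsCycle d) :
    Γ.IsCycle (c + d) := by
  refine ⟨fun e => ?_, fun v => ?_⟩
  · simp only [Pi.add_apply, hc.1 e, hd.1 e]; ring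
  · simp [Finset.sum_add_distrib, hc.2 v, hd.2 v]

theorem IsCycle.smul {c : Γ.E → ℝ} (r : ℝ) (hc : Γ.IsCycle c) : Γ.IsCycle (r • c) := by
  refine ⟨fun e => ?_, fun v => ?_⟩
  · simp [hc.1 e]
  · simp [← Finset.mul_sum, hc.2 v]

theorem isSupp_empty : IsSupp (∅ : Set Γ.E) := ⟨0, isCycle_zero, by simp⟩

open Classical in
/-- The net flow of a cycle into a vertex set vanishes. -/
theorem IsCycle.sum_entering {c : Γ.E → ℝ} (hc : Γ.IsCycle c) (W : Set Γ.V) :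
    ∑ e with Γ.t e ∈ W ∧ Γ.s e ∉ W, c e = 0 := by
  have h1 : ∑ e with Γ.t e ∈ W, c e = 0 := by
    rw [← Finset.sum_fiberwise_of_maps_to (g := Γ.t) (t := Finset.univ.filter (· ∈ W))
      (by simp)]
    refine Finset.sum_eq_zero fun v hv => ?_
    rw [← hc.2 v, Finset.filter_filter]
    refine Finset.sum_congr (Finset.filter_congr fun e _ => ?_) fun _ _ => rfl
    simp only [Finset.mem_filter, Finset.mem_univ, true_and] at hv
    exact ⟨fun h => h.2, fun h => ⟨h ▸ hv, h⟩⟩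
  have h2 : ∑ e with Γ.t e ∈ W ∧ Γ.s e ∈ W, c e = 0 := by
    refine Finset.sum_involution (fun e _ => Γ.inv e) ?_ ?_ ?_ ?_
    · intro e _; simp [hc.1 e]
    · intro e _ _; exact Γ.inv_ne e
    · intro e he
      simpa [Γ.s_inv, t_inv, and_comm] using he
    · intro e _; exact Γ.inv_inv e
  rw [← Finset.sum_filter_add_sum_filter_not _ (fun e => Γ.s e ∈ W), Finset.filter_filter,
    Finset.filter_filter, h2, zero_add] at h1
  exact h1

theorem Reach.symm_of_inv {A : Set Γ.E} (hA : ∀ e ∈ A, Γ.inv e ∈ A) {u v : Γ.V}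
    (h : Γ.Reach A u v) : Γ.Reach A v u := by
  induction h with
  | refl => exact Relation.ReflTransGen.refl
  | tail _ hbc ih =>
    obtain ⟨e, he, rfl, rfl⟩ := hbc
    exact Relation.ReflTransGen.head ⟨Γ.inv e, hA e he, Γ.s_inv e, t_inv e⟩ ih

/-- Counting the edges of a walk gives multiplicities whose boundary is the difference of the
end points. -/
theorem Reach.exists_multiplicity {A : Set Γ.E} {u v : Γ.V} (h : Γ.Reach A u v) :
    ∃ a : Γ.E → ℕ, (∀ e ∉ A, a e = 0) ∧ ∀ x,
      ∑ e with Γ.t e = x, a e + (if u = x then 1 else 0) =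
        ∑ e with Γ.s e = x, a e + (if v = x then 1 else 0) := by
  induction h with
  | refl => exact ⟨0, by simp, by simp⟩
  | tail _ hbc ih =>
    obtain ⟨a, ha, hbal⟩ := ih
    obtain ⟨e, he, rfl, rfl⟩ := hbc
    refine ⟨a + Pi.single e 1, fun f hf => ?_, fun x => ?_⟩
    · have : f ≠ e := fun h => hf (h ▸ he)
      simp [ha f hf, this]
    · have := hbal x
      simp only [Pi.add_apply, Finset.sum_add_distrib, Finset.sum_pi_single', Finset.mem_filter,
        Finset.mem_univ, true_and]
      omega

theorem exists_balanced_of_reach {A : Set Γ.E} {e : Γ.E} (h : Γ.Reach A (Γ.t e) (Γ.s e)) :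
    ∃ a : Γ.E → ℕ, Balanced a ∧ (∀ f ∉ A, f ≠ e → a f = 0) ∧ a e ≠ 0 := by
  obtain ⟨a, ha, hbal⟩ := h.exists_multiplicity
  refine ⟨a + Pi.single e 1, fun x => ?_, fun f hf hfe => by simp [ha f hf, hfe], by simp⟩
  simpa only [Pi.add_apply, Finset.sum_add_distrib, Finset.sum_pi_single', Finset.mem_filter,
        Finset.mem_univ, true_and] using hbal x

theorem exists_balanced_support {S : Set Γ.E}
    (h : ∀ e ∈ S, Γ.Reach S (Γ.t e) (Γ.s e)) :
    ∃ a : Γ.E → ℕ, Balanced a ∧ ∀ e, a e ≠ 0 ↔ e ∈ S := by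
  classical
  have h' : ∀ e : Γ.E, ∃ a : Γ.E → ℕ, Balanced a ∧ (∀ f ∉ S, a f = 0) ∧ (e ∈ S → a e ≠ 0) := by
    intro e
    by_cases he : e ∈ S
    · obtain ⟨a, hb, h0, hne⟩ := exists_balanced_of_reach (h e he)
      exact ⟨a, hb, fun f hf => h0 f hf fun hfe => hf (hfe ▸ he), fun _ => hne⟩
    · exact ⟨0, fun v => by simp, by simp, fun hh => absurd hh he⟩
  choose a hb h0 hne using h'
  refine ⟨∑ e, a e, fun v => ?_, fun e => ⟨fun hh => ?_, fun he => ?_⟩⟩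
  · simp only [Finset.sum_apply]
    rw [Finset.sum_comm, Finset.sum_comm (s := Finset.univ.filter (fun e => Γ.s e = v))]
    exact Finset.sum_congr rfl fun e _ => hb e v
  · by_contra he
    exact hh (by simp [Finset.sum_apply, h0 _ e he])
  · simp only [Finset.sum_apply, ne_eq, Finset.sum_eq_zero_iff, Finset.mem_univ, true_imp_iff]
    exact fun hh => hne e he (hh e)

theorem IsSupp.exists_balanced {S : Set Γ.E} (hS : IsSupp S) :
    ∃ a : Γ.E → ℕ, Balanced a ∧ ∀ e, a e ≠ 0 ↔ e ∈ S := by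
  classical
  refine exists_balanced_support fun e he => ?_
  obtain ⟨c, hc, rfl⟩ := hS
  set S := {e | 0 < c e}
  by_contra hns
  have hsum := hc.sum_entering {v | Γ.Reach S (Γ.t e) v}
  have hmem : e ∈ Finset.univ.filter fun f => Γ.t f ∈ {v | Γ.Reach S (Γ.t e) v} ∧
      Γ.s f ∉ {v | Γ.Reach S (Γ.t e) v} := by
    simp only [Finset.mem_filter, Finset.mem_univ, true_and, Set.mem_ofPred_eq]
    exact ⟨Relation.ReflTransGen.refl, hns⟩
  have hnn : ∀ f ∈ Finset.univ.filter fun f => Γ.t f ∈ {v | Γ.Reach S (Γ.t e) v} ∧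
      Γ.s f ∉ {v | Γ.Reach S (Γ.t e) v}, 0 ≤ c f := by
    intro f hf
    simp only [Finset.mem_filter, Finset.mem_univ, true_and, Set.mem_ofPred_eq] at hf
    by_contra hneg
    refine hf.2 (hf.1.tail ⟨Γ.inv f, ?_, Γ.s_inv f, t_inv f⟩)
    simp only [S, Set.mem_ofPred_eq, hc.1 f]
    linarith
  exact he.ne' ((Finset.sum_eq_zero_iff_of_nonneg hnn).1 hsum e hmem)

theorem Balanced.isCycle {a : Γ.E → ℕ} (ha : Balanced a) :
    Γ.IsCycle (fun e => (a e : ℝ) - a (Γ.inv e)) := by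
  refine ⟨fun e => by simp [Γ.inv_inv], fun v => ?_⟩
  have : ∑ e with Γ.t e = v, (a (Γ.inv e) : ℝ) = ∑ e with Γ.s e = v, (a e : ℝ) :=
    Finset.sum_nbij' Γ.inv Γ.inv (by simp [Γ.s_inv]) (by simp [t_inv])
      (by simp [Γ.inv_inv]) (by simp [Γ.inv_inv]) (by simp)
  rw [Finset.sum_sub_distrib, this, sub_eq_zero]
  exact_mod_cast ha v

theorem Balanced.isSupp {a : Γ.E → ℕ} (ha : Balanced a)
    (hanti : ∀ e, a e ≠ 0 → a (Γ.inv e) = 0) : IsSupp {e | a e ≠ 0} := by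
  refine ⟨_, ha.isCycle, ?_⟩
  ext e
  simp only [Set.mem_ofPred_eq, sub_pos, Nat.cast_lt]
  have := hanti e
  omega

/-- A cycle can be perturbed so that it keeps its positive edges and takes prescribed values where
it vanished. -/
theorem IsCycle.exists_perturb {c z : Γ.E → ℝ} (hc : Γ.IsCycle c) (hz : Γ.IsCycle z) :
    ∃ u : Γ.E → ℝ, Γ.IsCycle u ∧ (∀ e, 0 < c e → 0 < u e) ∧ ∀ e, c e = 0 → u e = z e := by
  refine ⟨(1 + ∑ e, |z e / c e|) • c + z, (hc.smul _).add hz, fun e he => ?_, fun e he => ?_⟩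
  · have h1 : |z e / c e| ≤ ∑ e, |z e / c e| :=
      Finset.single_le_sum (f := fun e => |z e / c e|) (fun _ _ => abs_nonneg _)
        (Finset.mem_univ e)
    have h2 : -z e ≤ |z e / c e| * c e := by
      rw [abs_div, abs_of_pos he, div_mul_cancel₀ _ he.ne']
      exact neg_le_abs _
    simp only [Pi.add_apply, Pi.smul_apply, smul_eq_mul]
    nlinarith
  · simp [he]

theorem eq_zero_of_maximal {S : Set Γ.E} (hS : Maximal IsSupp S) {z : Γ.E → ℝ}
    (hz : Γ.IsCycle z) {e : Γ.E} (he : e ∉ S) (he' : Γ.inv e ∉ S) : z e = 0 := by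
  have key : ∀ z : Γ.E → ℝ, Γ.IsCycle z → ∀ e, e ∉ S → Γ.inv e ∉ S → ¬ 0 < z e := by
    intro z hz e he he' hpos
    obtain ⟨c, hc, hSc⟩ := hS.1
    obtain ⟨u, hu, hu1, hu2⟩ := hc.exists_perturb hz
    have hce : c e = 0 := by
      simp only [hSc, Set.mem_ofPred_eq, hc.1 e] at he he'
      linarith
    have hle : S ≤ {e | 0 < u e} := fun f hf => hu1 f (by rw [hSc] at hf; exact hf)
    exact he (hS.2 ⟨u, hu, rfl⟩ hle (by simpa [hu2 e hce] using hpos))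
  refine le_antisymm (not_lt.1 (key z hz e he he')) ?_
  have := key z hz (Γ.inv e) he' (by rwa [Γ.inv_inv])
  rw [hz.1 e] at this
  linarith

theorem mem_Esep_iff (e : Γ.E) :
    e ∈ Γ.Esep ↔ ¬ Γ.Reach {f | f ≠ e ∧ f ≠ Γ.inv e} (Γ.t e) (Γ.s e) := by
  set A : Set Γ.E := {f | f ≠ e ∧ f ≠ Γ.inv e} with hA
  have hAinv : ∀ f ∈ A, Γ.inv f ∈ A := by
    rintro f ⟨h1, h2⟩
    refine ⟨fun h => h2 ?_, fun h => h1 ?_⟩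
    · rw [← h, Γ.inv_inv]
    · rw [← Γ.inv_inv f, h, Γ.inv_inv]
  have hquot : ∀ {u v : Γ.V}, Γ.Reach A u v →
      Quot.mk (fun a b : Γ.V => ∃ e ∈ A, Γ.s e = a ∧ Γ.t e = b) u = Quot.mk _ v := by
    intro u v h
    induction h with
    | refl => rfl
    | tail _ hbc ih => exact ih.trans (Quot.sound hbc)
  change Γ.numComponents Set.univ < Γ.numComponents A ↔ _
  rw [← not_le, not_iff_not]
  constructor
  · intro h
    let F : Quot (fun a b : Γ.V => ∃ e ∈ A, Γ.s e = a ∧ Γ.t e = b) →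
        Quot (fun a b : Γ.V => ∃ e ∈ (Set.univ : Set Γ.E), Γ.s e = a ∧ Γ.t e = b) :=
      Quot.map id (by rintro a b ⟨e, _, h⟩; exact ⟨e, trivial, h⟩)
    have hF : Function.Surjective F := by
      rintro ⟨v⟩; exact ⟨Quot.mk _ v, rfl⟩
    have hFi := (hF.bijective_of_nat_card_le h).1
    have heq : Quot.mk (fun a b : Γ.V => ∃ e ∈ A, Γ.s e = a ∧ Γ.t e = b) (Γ.t e) =
        Quot.mk _ (Γ.s e) :=
      hFi (Quot.sound ⟨e, trivial, rfl, rfl⟩ : F (Quot.mk _ (Γ.s e)) = F (Quot.mk _ (Γ.t e))).symm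
    have hgen : ∀ {u v : Γ.V}, Relation.EqvGen
        (fun a b : Γ.V => ∃ e ∈ A, Γ.s e = a ∧ Γ.t e = b) u v → Γ.Reach A u v := by
      intro u v h
      induction h with
      | rel a b h => exact Relation.ReflTransGen.single h
      | refl a => exact Relation.ReflTransGen.refl
      | symm a b _ ih => exact Reach.symm_of_inv hAinv ih
      | trans a b c _ _ ih1 ih2 => exact Relation.ReflTransGen.trans ih1 ih2
    exact hgen (Quot.eqvGen_exact heq)
  · intro h
    have hs : ∀ f : Γ.E, Quot.mk (fun a b : Γ.V => ∃ e ∈ A, Γ.s e = a ∧ Γ.t e = b) (Γ.s f) =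
        Quot.mk _ (Γ.t f) := by
      intro f
      by_cases hf : f ∈ A
      · exact Quot.sound ⟨f, hf, rfl, rfl⟩
      · simp only [hA, Set.mem_ofPred_eq, not_and_or, not_not] at hf
        rcases hf with rfl | rfl
        · exact (hquot h).symm
        · rw [Γ.s_inv, t_inv]; exact hquot h
    refine Nat.card_le_card_of_surjective
      (Quot.lift (Quot.mk _) (by rintro a b ⟨f, _, rfl, rfl⟩; exact hs f)) ?_
    rintro ⟨v⟩; exact ⟨Quot.mk _ v, rfl⟩

theorem IsCycle.eq_zero_of_mem_Esep {c : Γ.E → ℝ} (hc : Γ.IsCycle c) {e : Γ.E}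
    (he : e ∈ Γ.Esep) : c e = 0 := by
  classical
  rw [mem_Esep_iff] at he
  set A : Set Γ.E := {f | f ≠ e ∧ f ≠ Γ.inv e}
  rw [← hc.sum_entering {v | Γ.Reach A (Γ.t e) v}]
  symm
  refine Finset.sum_eq_single_of_mem e ?_ fun f hf hfe => ?_
  · simp only [Finset.mem_filter, Finset.mem_univ, true_and, Set.mem_ofPred_eq]
    exact ⟨Relation.ReflTransGen.refl, he⟩
  · simp only [Finset.mem_filter, Finset.mem_univ, true_and, Set.mem_ofPred_eq] at hf
    exfalso
    by_cases hfi : f = Γ.inv e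
    · subst hfi
      rw [t_inv] at hf
      exact he hf.1
    · refine hf.2 (hf.1.tail ⟨Γ.inv f, ⟨fun h => hfi ?_, fun h => hfe ?_⟩, Γ.s_inv f, t_inv f⟩)
      · rw [← h, Γ.inv_inv]
      · rw [← Γ.inv_inv f, h, Γ.inv_inv]

theorem exists_isCycle_of_notMem_Esep {e : Γ.E} (he : e ∉ Γ.Esep) :
    ∃ z : Γ.E → ℝ, Γ.IsCycle z ∧ z e ≠ 0 := by
  rw [mem_Esep_iff, not_not] at he
  obtain ⟨a, hb, h0, hne⟩ := exists_balanced_of_reach he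
  refine ⟨_, hb.isCycle, ?_⟩
  simpa [h0 (Γ.inv e) (by simp) (Γ.inv_ne e)] using hne

theorem isTotallyCyclic_Esep_iff (O : Set Γ.E) :
    Γ.IsTotallyCyclic Γ.Esep O ↔ Maximal IsSupp O := by
  classical
  constructor
  · rintro ⟨⟨h1, h2⟩, h3⟩
    have hanti : ∀ e ∈ O, Γ.inv e ∉ O := fun e he => (h2 e (h1 e he)).1 he
    have hreach : ∀ e ∈ O, Γ.Reach O (Γ.t e) (Γ.s e) := by
      intro e he
      by_contra hns
      refine h3 ⟨{v | ¬ Γ.Reach O (Γ.t e) v}, ⟨Γ.s e, hns, Γ.t e, ?_, ?_⟩, ?_⟩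
      · exact not_not_intro Relation.ReflTransGen.refl
      · exact Relation.ReflTransGen.single ⟨e, h1 e he, rfl, rfl⟩
      · exact fun f hf ht hs => ht (hs.tail ⟨f, hf, rfl, rfl⟩)
    obtain ⟨a, ha, hsupp⟩ := exists_balanced_support hreach
    constructor
    · have hO : O = {e | a e ≠ 0} := by ext e; exact (hsupp e).symm
      rw [hO]
      refine ha.isSupp fun e he => ?_
      by_contra hh
      exact hanti e ((hsupp e).1 he) ((hsupp _).1 hh)
    · intro S hS hOS e he
      by_contra heO
      have heT : e ∉ Γ.Esep := by
        obtain ⟨c, hc, rfl⟩ := hS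
        exact fun hT => he.ne' (hc.eq_zero_of_mem_Esep hT)
      have : Γ.inv e ∈ O := by
        by_contra hh
        exact heO ((h2 e heT).2 hh)
      exact hS.inv_notMem he (hOS this)
  · intro hO
    have hor : Γ.IsOrientation Γ.Esep O := by
      refine ⟨fun e he hT => ?_, fun e heT => ⟨fun h => hO.1.inv_notMem h, fun h => ?_⟩⟩
      · obtain ⟨c, hc, rfl⟩ := hO.1
        exact he.ne' (hc.eq_zero_of_mem_Esep hT)
      · by_contra heO
        obtain ⟨z, hz, hne⟩ := exists_isCycle_of_notMem_Esep heT
        exact hne (eq_zero_of_maximal hO hz heO h)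
    refine ⟨hor, ?_⟩
    rintro ⟨W, ⟨v, hv, w, hw, hvw⟩, hW⟩
    obtain ⟨c, hc, hOc⟩ := hO.1
    have hnp : ∀ f ∈ Finset.univ.filter fun f => Γ.t f ∈ W ∧ Γ.s f ∉ W, c f ≤ 0 := by
      intro f hf
      simp only [Finset.mem_filter, Finset.mem_univ, true_and] at hf
      by_contra hpos
      exact hf.2 (hW f (by rw [hOc]; exact not_le.1 hpos) hf.1)
    have hzero := (Finset.sum_eq_zero_iff_of_nonpos hnp).1 (hc.sum_entering W)
    refine hw ?_
    clear hw
    induction hvw with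
    | refl => exact hv
    | tail _ hbc ih =>
      obtain ⟨f, hf, rfl, rfl⟩ := hbc
      by_contra ht
      have h0 : c (Γ.inv f) = 0 := hzero _ (by
        simp only [Finset.mem_filter, Finset.mem_univ, true_and, t_inv, Γ.s_inv]
        exact ⟨ih, ht⟩)
      have hf0 : c f = 0 := by
        have := hc.1 f
        linarith
      have hfO : f ∉ O := by rw [hOc]; simp [hf0]
      have hfO' : Γ.inv f ∉ O := by rw [hOc]; simp [h0]
      exact hfO ((hor.2 f hf).2 hfO')

/-- The space of real cycles supported on `S` and the reverses of `S`. -/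
def cyclesOn (S : Set Γ.E) : Submodule ℝ (Γ.E → ℝ) where
  carrier := {c | Γ.IsCycle c ∧ ∀ e, e ∉ S → Γ.inv e ∉ S → c e = 0}
  add_mem' hc hd := ⟨hc.1.add hd.1, fun e h h' => by simp [hc.2 e h h', hd.2 e h h']⟩
  zero_mem' := ⟨isCycle_zero, by simp⟩
  smul_mem' r c hc := ⟨hc.1.smul r, fun e h h' => by simp [hc.2 e h h']⟩

theorem finrank_cyclesOn_empty : Module.finrank ℝ (cyclesOn (∅ : Set Γ.E)) = 0 := by
  have : cyclesOn (∅ : Set Γ.E) = ⊥ := by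
    rw [eq_bot_iff]
    intro c hc
    exact funext fun e => hc.2 e (by simp) (by simp)
  rw [this, finrank_bot]

theorem b1_eq_finrank_univ : Γ.b1 = Module.finrank ℝ (cyclesOn (Set.univ : Set Γ.E)) := by
  have : {c : Γ.E → ℝ | Γ.IsCycle c} = (cyclesOn (Set.univ : Set Γ.E) : Set (Γ.E → ℝ)) := by
    ext c
    exact ⟨fun h => ⟨h, by simp⟩, fun h => h.1⟩
  rw [b1, this, Submodule.span_eq]

theorem b1_eq_finrank_of_maximal {S : Set Γ.E} (hS : Maximal IsSupp S) :
    Γ.b1 = Module.finrank ℝ (cyclesOn S) := by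
  have : cyclesOn S = cyclesOn Set.univ := by
    ext c
    exact ⟨fun h => ⟨h.1, by simp⟩,
      fun h => ⟨h.1, fun e he he' => eq_zero_of_maximal hS h.1 he he'⟩⟩
  rw [b1_eq_finrank_univ, this]

/-- Every nonempty cone of nonnegative cycles has a facet. -/
theorem IsSupp.exists_facet {S : Set Γ.E} (hS : IsSupp S) (hne : S.Nonempty) :
    ∃ S', IsSupp S' ∧ S' ⊂ S ∧
      Module.finrank ℝ (cyclesOn S) ≤ Module.finrank ℝ (cyclesOn S') + 1 := by
  classical
  obtain ⟨S', -, hmax⟩ := Finite.exists_le_maximal (p := fun S' => IsSupp S' ∧ S' ⊂ S)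
    (a := ∅) ⟨isSupp_empty, Set.empty_ssubset.2 hne⟩
  obtain ⟨hS', hss⟩ := hmax.1
  refine ⟨S', hS', hss, ?_⟩
  obtain ⟨x, hx, rfl⟩ := hS
  obtain ⟨y, hy, rfl⟩ := hS'
  set S := {e | 0 < x e}
  set S' := {e | 0 < y e}
  have hle : cyclesOn S ≤ cyclesOn S' ⊔ Submodule.span ℝ {x} := by
    intro z hz
    have hD : (Finset.univ.filter fun e => e ∈ S ∧ e ∉ S').Nonempty := by
      obtain ⟨e, he, he'⟩ := Set.exists_of_ssubset hss
      exact ⟨e, by simp [he, he']⟩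
    obtain ⟨e₀, he₀, hmin⟩ := Finset.exists_min_image _ (fun e => z e / x e) hD
    simp only [Finset.mem_filter, Finset.mem_univ, true_and] at he₀ hmin
    set r := z e₀ / x e₀
    set w := z + (-r) • x
    have hwcyc : Γ.IsCycle w := hz.1.add (hx.smul _)
    have hw0 : w e₀ = 0 := by
      have : x e₀ ≠ 0 := (he₀.1 : 0 < x e₀).ne'
      simp [w, r, this]
    have hwnn : ∀ e, e ∈ S → e ∉ S' → 0 ≤ w e := by
      intro e he he'
      have := hmin e ⟨he, he'⟩
      rw [le_div_iff₀ he] at this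
      simp only [w, Pi.add_apply, Pi.smul_apply, smul_eq_mul]
      linarith
    have hwS : ∀ e, e ∉ S → Γ.inv e ∉ S → w e = 0 := by
      intro e he he'
      have hxe : x e = 0 := by
        simp only [S, Set.mem_ofPred_eq, hx.1 e] at he he'
        linarith
      simp [w, hxe, hz.2 e he he']
    have hy0 : ∀ e, e ∉ S' → Γ.inv e ∉ S' → y e = 0 := by
      intro e he he'
      simp only [S', Set.mem_ofPred_eq, hy.1 e] at he he'
      linarith
    have hSinv : ∀ e ∈ S, Γ.inv e ∉ S := fun e he => IsSupp.inv_notMem ⟨x, hx, rfl⟩ he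
    have hwS' : ∀ e, e ∈ S → e ∉ S' → w e = 0 := by
      intro e he he'
      by_contra hwe
      have hpos : 0 < w e := lt_of_le_of_ne (hwnn e he he') (Ne.symm hwe)
      obtain ⟨u, hu, hu1, hu2⟩ := hy.exists_perturb hwcyc
      have hy0' : ∀ e ∈ S, e ∉ S' → y e = 0 := fun e he he' =>
        hy0 e he' fun h => hSinv e he (hss.1 h)
      have hSu : {e | 0 < u e} ⊂ S := by
        refine ⟨fun f hf => ?_, fun h => ?_⟩
        · by_contra hfS
          by_cases hfS' : Γ.inv f ∈ S
          · by_cases hfi : Γ.inv f ∈ S'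
            · have := hu1 _ hfi
              rw [hu.1 f] at this
              have : 0 < u f := hf
              linarith
            · have h1 := hwnn _ hfS' hfi
              rw [← hu2 _ (hy0' _ hfS' hfi), hu.1 f] at h1
              have : 0 < u f := hf
              linarith
          · have h1 : u f = 0 := by
              rw [hu2 f (hy0 f (fun h => hfS (hss.1 h)) (fun h => hfS' (hss.1 h))), hwS f hfS hfS']
            have : 0 < u f := hf
            linarith
        · have : 0 < u e₀ := h he₀.1
          rw [hu2 e₀ (hy0' e₀ he₀.1 he₀.2), hw0] at this
          exact lt_irrefl _ this
      have hsub : {e | 0 < u e} ⊆ S' := hmax.2 ⟨⟨u, hu, rfl⟩, hSu⟩ fun f hf => hu1 f hf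
      exact he' (hsub (by simpa [hu2 e (hy0' e he he')] using hpos))
    have hwmem : w ∈ cyclesOn S' := by
      refine ⟨hwcyc, fun e he he' => ?_⟩
      by_cases h1 : e ∈ S
      · exact hwS' e h1 he
      · by_cases h2 : Γ.inv e ∈ S
        · have := hwS' _ h2 he'
          rw [hwcyc.1 e] at this
          linarith
        · exact hwS e h1 h2
    have hzw : z = w + r • x := by
      simp [w]
    rw [hzw]
    exact Submodule.add_mem_sup hwmem (Submodule.smul_mem _ _ (Submodule.mem_span_singleton_self x))
  calc Module.finrank ℝ (cyclesOn S)
      ≤ Module.finrank ℝ ↥(cyclesOn S' ⊔ Submodule.span ℝ {x}) := Submodule.finrank_mono hle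
    _ ≤ Module.finrank ℝ (cyclesOn S') + Module.finrank ℝ (Submodule.span ℝ {x}) :=
        Submodule.finrank_add_le_finrank_add_finrank _ _
    _ ≤ Module.finrank ℝ (cyclesOn S') + 1 := by
        gcongr
        simpa using finrank_span_le_card (R := ℝ) ({x} : Set (Γ.E → ℝ))

end Flows

end SerreGraph

section ChainsOfPrimes

open MvPolynomial

/-- Elements separating the consecutive members of a chain of primes are algebraically independent
modulo the smallest one. -/
theorem MvPolynomial.eq_zero_of_aeval_mem_of_chain {k R : Type*} [Field k] [CommRing R]
    [Algebra k R] {n : ℕ} (p : Fin (n + 1) → Ideal R) (hprime : ∀ i, (p i).IsPrime)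
    (hle : ∀ i : Fin n, p i.castSucc ≤ p i.succ) (x : Fin n → R)
    (hx : ∀ i : Fin n, x i ∈ p i.succ) (hx' : ∀ i : Fin n, x i ∉ p i.castSucc)
    (F : MvPolynomial (Fin n) k) (hF : aeval x F ∈ p 0) : F = 0 := by
  induction n with
  | zero =>
    rw [eq_C_of_isEmpty F, aeval_C] at hF
    by_contra hne
    have hc : coeff 0 F ≠ 0 := fun h => hne (by rw [eq_C_of_isEmpty F, h, C_0])
    exact (hprime 0).ne_top
      (Ideal.eq_top_of_isUnit_mem _ hF ((isUnit_iff_ne_zero.2 hc).map (algebraMap k R)))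
  | succ n ih =>
    have hev : ∀ F : MvPolynomial (Fin (n + 1)) k, aeval x F = Polynomial.eval₂
        (aeval (fun i : Fin n => x i.succ) : MvPolynomial (Fin n) k →ₐ[k] R).toRingHom (x 0)
        (finSuccEquiv k n F) := by
      intro F
      induction F using MvPolynomial.induction_on with
      | C a => simp [finSuccEquiv_apply]
      | add p q hp hq => simp [hp, hq, Polynomial.eval₂_add]
      | mul_X p i hp =>
        rw [map_mul, map_mul, Polynomial.eval₂_mul, hp]
        congr 1
        refine Fin.cases ?_ (fun j => ?_) i
        · simp [finSuccEquiv_X_zero]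
        · simp [finSuccEquiv_X_succ]
    rw [hev] at hF
    have key : ∀ (N : ℕ) (f : Polynomial (MvPolynomial (Fin n) k)), f.natDegree ≤ N →
        Polynomial.eval₂ (aeval (fun i : Fin n => x i.succ) :
          MvPolynomial (Fin n) k →ₐ[k] R).toRingHom (x 0) f ∈ p 0 → f = 0 := by
      intro N
      induction N with
      | zero | succ N ihN =>
        intro f hd hf
        have h0 : f.coeff 0 = 0 := by
          refine ih (fun i => p i.succ) (fun i => hprime _) (fun i => hle i.succ)
            (fun i => x i.succ) (fun i => hx _) (fun i => hx' i.succ) _ ?_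
          rw [← Polynomial.divX_mul_X_add f, Polynomial.eval₂_add, Polynomial.eval₂_mul,
            Polynomial.eval₂_X, Polynomial.eval₂_C] at hf
          exact (Ideal.add_mem_iff_right _ (Ideal.mul_mem_left _ _ (hx 0))).1 (hle 0 hf)
        have hdiv := Polynomial.divX_mul_X_add f
        rw [h0, Polynomial.C_0, add_zero] at hdiv
        first
        | rw [Polynomial.eq_C_of_natDegree_le_zero hd, h0, Polynomial.C_0]
        | rw [← hdiv, Polynomial.eval₂_mul, Polynomial.eval₂_X] at hf
          rw [← hdiv, ihN f.divX (by rw [Polynomial.natDegree_divX_eq_natDegree_tsub_one]; omega)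
            (((hprime 0).mem_or_mem hf).resolve_right (hx' 0)), zero_mul]
    exact (map_eq_zero_iff _ (finSuccEquiv k n).injective).1 (key _ _ le_rfl hF)

/-- Rational vectors independent over `ℚ` stay independent over `ℝ`. -/
theorem LinearIndependent.real_of_rat {ι σ : Type*} {v : ι → σ → ℚ} (hv : LinearIndependent ℚ v) :
    LinearIndependent ℝ (fun i e => (v i e : ℝ)) := by
  rw [linearIndependent_iff'] at hv ⊢
  intro s g hg i hi
  rw [← Module.forall_dual_apply_eq_zero_iff ℚ]
  intro φ
  refine hv s (fun i => φ (g i)) ?_ i hi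
  ext e
  have := congrArg φ (congrFun hg e)
  simp only [Finset.sum_apply, Pi.smul_apply, smul_eq_mul, Pi.zero_apply, map_zero, map_sum]
    at this ⊢
  rw [← this]
  refine Finset.sum_congr rfl fun j _ => ?_
  rw [mul_comm (g j), ← Rat.smul_def, map_smul, smul_eq_mul, mul_comm]

/-- The exponents of algebraically independent monomials are linearly independent. -/
theorem AlgebraicIndependent.linearIndependent_of_monomial {k ι σ : Type*} [Field k]
    {a : ι → σ →₀ ℕ} (h : AlgebraicIndependent k (fun i => monomial (a i) (1 : k))) :
    LinearIndependent ℝ (fun i e => ((a i e : ℕ) : ℝ)) := by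
  classical
  have hZ : LinearIndependent ℤ (fun i e => ((a i e : ℕ) : ℚ)) := by
    rw [linearIndependent_iff']
    intro s g hg i hi
    have hev : ∀ n : ι → ℕ, aeval (fun i => monomial (a i) (1 : k))
        (∏ i ∈ s, X i ^ n i : MvPolynomial ι k) = monomial (∑ i ∈ s, n i • a i) (1 : k) := by
      intro n
      simp [map_prod, monomial_pow, monomial_sum_one]
    have hsum : ∑ i ∈ s, (g i).toNat • a i = ∑ i ∈ s, (-g i).toNat • a i := by
      ext e
      have : ∑ i ∈ s, (g i : ℚ) * (a i e : ℚ) = 0 := by simpa using congrFun hg e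
      have h2 : ∑ i ∈ s, g i * (a i e : ℤ) = 0 := by exact_mod_cast this
      simp only [Finsupp.coe_finsetSum, Finset.sum_apply, Finsupp.smul_apply, smul_eq_mul]
      zify
      rw [← sub_eq_zero, ← Finset.sum_sub_distrib, ← h2]
      refine Finset.sum_congr rfl fun j _ => ?_
      rw [← sub_mul]
      congr 1
      omega
    have hprod := h (((hev fun i => (g i).toNat).trans (by rw [hsum])).trans
      (hev fun i => (-g i).toNat).symm)
    have hmon : ∀ n : ι → ℕ, (∏ i ∈ s, X i ^ n i : MvPolynomial ι k) =
        monomial (∑ i ∈ s, Finsupp.single i (n i)) 1 := by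
      intro n
      simp [monomial_sum_one, X_pow_eq_monomial]
    rw [hmon fun i => (g i).toNat, hmon fun i => (-g i).toNat] at hprod
    have := DFunLike.congr_fun (monomial_left_injective (one_ne_zero (α := k)) hprod) i
    simp only [Finsupp.coe_finsetSum, Finset.sum_apply, Finsupp.single_apply,
      Finset.sum_ite_eq', hi, if_true] at this
    omega
  simpa using ((LinearIndependent.iff_fractionRing ℤ ℚ).1 hZ).real_of_rat

/-- The number of algebraically independent elements in an algebra generated by monomials is
bounded by the dimension of a space containing the exponents. -/
theorem AlgebraicIndependent.card_le_finrank_of_mem_adjoin_monomial {k σ : Type*} [Field k]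
    [Finite σ] {M : Set (σ →₀ ℕ)} {W : Submodule ℝ (σ → ℝ)}
    (hMW : ∀ a ∈ M, (fun e => ((a e : ℕ) : ℝ)) ∈ W) {n : ℕ} {y : Fin n → MvPolynomial σ k}
    (hy : AlgebraicIndependent k y)
    (hyB : ∀ i, y i ∈ Algebra.adjoin k ((fun a => monomial a (1 : k)) '' M)) :
    n ≤ Module.finrank ℝ W := by
  set G : Set (MvPolynomial σ k) := (fun a => monomial a (1 : k)) '' M
  let B := Algebra.adjoin k G
  let y' : Fin n → B := fun i => ⟨y i, hyB i⟩
  have hy' : AlgebraicIndependent k y' :=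
    (B.val.algebraicIndependent_iff Subtype.val_injective).1 hy
  let s : Set B := Subtype.val ⁻¹' G
  have hs : Algebra.adjoin k s = ⊤ := Algebra.adjoin_adjoin_coe_preimage
  have : Algebra.IsAlgebraic (Algebra.adjoin k s) B := by
    refine ⟨fun b => ?_⟩
    exact isAlgebraic_algebraMap (A := B) (⟨b, hs ▸ trivial⟩ : Algebra.adjoin k s)
  obtain ⟨t, hts, ht⟩ := exists_isTranscendenceBasis_subset (R := k) s
  have hmon : ∀ i : t, ∃ a ∈ M, monomial a (1 : k) = (i : B).1 := fun i => hts i.2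
  choose a haM ha using hmon
  have hind : AlgebraicIndependent k (fun i : t => monomial (a i) (1 : k)) := by
    have := (B.val.algebraicIndependent_iff Subtype.val_injective).2 ht.1
    convert this using 1
    exact funext ha
  have hlin : LinearIndependent ℝ (fun i : t => (⟨_, hMW _ (haM i)⟩ : W)) :=
    LinearIndependent.of_comp W.subtype hind.linearIndependent_of_monomial
  have hfin : Finite t := hlin.finite
  have := Fintype.ofFinite t
  have h1 := hlin.fintype_card_le_finrank
  have h2 := hy'.lift_cardinalMk_le_trdeg
  rw [← ht.cardinalMk_eq_trdeg] at h2
  simp only [Fintype.card_fin, Cardinal.lift_natCast, Cardinal.mk_fintype, Nat.cast_le] at h2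
  exact h2.trans h1

end ChainsOfPrimes

namespace SerreGraph

section Invariants

open MvPolynomial

variable {k : Type*} [Field k] {Γ : SerreGraph}

open Classical in
/-- The endomorphism of `k[U_e]` that sets the variables outside `S` to zero. -/
noncomputable def killHom (k : Type*) [Field k] (S : Set Γ.E) :
    MvPolynomial Γ.E k →ₐ[k] MvPolynomial Γ.E k :=
  aeval fun e => if e ∈ S then X e else 0

open Classical in
theorem killHom_monomial (S : Set Γ.E) (a : Γ.E →₀ ℕ) (c : k) :
    killHom k S (monomial a c) = if ∀ e, a e ≠ 0 → e ∈ S then monomial a c else 0 := by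
  rw [killHom, aeval_monomial]
  split_ifs with h
  · rw [monomial_eq, algebraMap_eq]
    congr 1
    refine Finset.prod_congr rfl fun e he => ?_
    simp [h e (Finsupp.mem_support_iff.1 he)]
  · push Not at h
    obtain ⟨e, he, heS⟩ := h
    rw [Finsupp.prod, Finset.prod_eq_zero (Finsupp.mem_support_iff.2 he), mul_zero]
    simp [heS, he]

open Classical in
theorem coeff_killHom (S : Set Γ.E) (a : Γ.E →₀ ℕ) (f : MvPolynomial Γ.E k) :
    coeff a (killHom k S f) = if ∀ e, a e ≠ 0 → e ∈ S then coeff a f else 0 := by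
  induction f using MvPolynomial.induction_on' with
  | monomial b c =>
    rw [killHom_monomial]
    by_cases hab : b = a
    · subst hab
      split_ifs <;> simp
    · split_ifs <;> simp [coeff_monomial, hab]
  | add f g hf hg =>
    rw [map_add, coeff_add, hf, hg]
    split_ifs <;> simp

/-- The homomorphism from `A(Γ)` to a polynomial ring that keeps exactly the variables `U_e`
with `e ∈ S` and `ι(e) ∉ S`. -/
noncomputable def restrict (k : Type*) [Field k] (S : Set Γ.E) :
    Γ.Aring k →ₐ[k] MvPolynomial Γ.E k :=
  Ideal.Quotient.liftₐ (Γ.relIdeal k) (killHom k {e | e ∈ S ∧ Γ.inv e ∉ S}) <| by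
    have : Γ.relIdeal k ≤ RingHom.ker (killHom k {e | e ∈ S ∧ Γ.inv e ∉ S}) := by
      rw [relIdeal, Ideal.span_le]
      rintro q ⟨e, rfl⟩
      simp only [killHom, SetLike.mem_coe, RingHom.mem_ker, map_mul, aeval_X, Set.mem_ofPred_eq,
        Γ.inv_inv]
      by_cases h : e ∈ S <;> simp [h, Γ.inv_inv]
    exact fun a ha => RingHom.mem_ker.1 (this ha)

open Classical in
theorem coeff_restrict_mk {S : Set Γ.E} (hS : ∀ e ∈ S, Γ.inv e ∉ S) (a : Γ.E →₀ ℕ)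
    (f : MvPolynomial Γ.E k) :
    coeff a (restrict k S (Ideal.Quotient.mk _ f)) =
      if ∀ e, a e ≠ 0 → e ∈ S then coeff a f else 0 := by
  have : {e | e ∈ S ∧ Γ.inv e ∉ S} = S := by
    ext e
    exact ⟨fun h => h.1, fun h => ⟨h, hS e h⟩⟩
  have h : restrict k S (Ideal.Quotient.mk _ f) = killHom k {e | e ∈ S ∧ Γ.inv e ∉ S} f := rfl
  rw [h, this, coeff_killHom]

theorem eq_zero_of_restrict_eq_zero {r : Γ.Aring k}
    (h : ∀ S : Set Γ.E, (∀ e ∈ S, Γ.inv e ∉ S) → restrict k S r = 0) : r = 0 := by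
  classical
  obtain ⟨f, rfl⟩ := Ideal.Quotient.mk_surjective r
  rw [Ideal.Quotient.eq_zero_iff_mem]
  have hrel : Γ.relIdeal k = Ideal.span ((fun a => monomial a (1 : k)) ''
      Set.range fun e => Finsupp.single e 1 + Finsupp.single (Γ.inv e) 1) := by
    rw [relIdeal, ← Set.range_comp]
    congr 1
    ext q
    simp [X, monomial_mul, eq_comm]
  rw [hrel, mem_ideal_span_monomial_image]
  intro a ha
  by_contra! hne
  have hanti : ∀ e, a e ≠ 0 → a (Γ.inv e) = 0 := by
    intro e he
    by_contra he'
    refine hne _ ⟨e, rfl⟩ fun f => ?_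
    simp only [Finsupp.add_apply, Finsupp.single_apply]
    have := Γ.inv_ne e
    split_ifs with h1 h2 h2
    · exact absurd (h2.trans h1.symm) this
    · subst h1; omega
    · subst h2; omega
    · omega
  have := congrArg (coeff a) (h {e | a e ≠ 0} fun e he => by simpa using hanti e he)
  rw [coeff_restrict_mk (fun e he => by simpa using hanti e he)] at this
  simp at this
  exact mem_support_iff.1 ha this

theorem isReduced_invariants : IsReduced (Γ.invariants k) := by
  refine ⟨fun r hr => Subtype.ext (eq_zero_of_restrict_eq_zero fun S _ => ?_)⟩
  exact ((hr.map (Γ.invariants k).val).map (restrict k S)).eq_zero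

/-- The weight by which `lam` acts on the monomial with exponent `a`. -/
def weight (lam : Γ.V → kˣ) (a : Γ.E → ℕ) : kˣ :=
  ∏ e, (lam (Γ.s e) * (lam (Γ.t e))⁻¹) ^ a e

theorem weight_eq (lam : Γ.V → kˣ) (a : Γ.E → ℕ) :
    weight lam a = (∏ v, lam v ^ ∑ e with Γ.s e = v, a e) *
      (∏ v, lam v ^ ∑ e with Γ.t e = v, a e)⁻¹ := by
  have key : ∀ g : Γ.E → Γ.V,
      ∏ v, lam v ^ ∑ e with g e = v, a e = ∏ e, lam (g e) ^ a e := by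
    intro g
    rw [← Finset.prod_fiberwise Finset.univ g]
    refine Finset.prod_congr rfl fun v _ => ?_
    rw [← Finset.prod_pow_eq_pow_sum]
    exact Finset.prod_congr rfl fun e he => by rw [(Finset.mem_filter.1 he).2]
  rw [key, key, weight, ← Finset.prod_inv_distrib, ← Finset.prod_mul_distrib]
  simp [mul_pow]

theorem Balanced.weight_eq_one {a : Γ.E → ℕ} (ha : Balanced a) (lam : Γ.V → kˣ) :
    weight lam a = 1 := by
  rw [weight_eq, mul_inv_eq_one]
  exact Finset.prod_congr rfl fun v _ => by rw [ha v]

theorem eq_of_forall_units_pow_eq [Infinite k] {m n : ℕ} (h : ∀ u : kˣ, u ^ m = u ^ n) :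
    m = n := by
  have : (Polynomial.X ^ (m + 1) : Polynomial k) = Polynomial.X ^ (n + 1) := by
    refine Polynomial.funext fun x => ?_
    rcases eq_or_ne x 0 with rfl | hx
    · simp
    · have := congrArg Units.val (h (Units.mk0 x hx))
      simp only [Units.val_pow_eq_pow_val, Units.val_mk0] at this
      simp [pow_succ, this]
  simpa using congrArg Polynomial.natDegree this

theorem balanced_of_weight_eq_one [Infinite k] {a : Γ.E → ℕ}
    (h : ∀ lam : Γ.V → kˣ, weight lam a = 1) : Balanced a := by
  refine fun v => (eq_of_forall_units_pow_eq (k := k) fun u => ?_).symm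
  have := h (Function.update 1 v u)
  rw [weight_eq, mul_inv_eq_one] at this
  have key : ∀ m : Γ.V → ℕ, ∏ w, (Function.update (1 : Γ.V → kˣ) v u) w ^ m w = u ^ m v := by
    intro m
    rw [Finset.prod_eq_single v] <;> simp +contextual [Function.update_of_ne]
  rwa [key fun v => _, key fun v => _] at this

/-- The action of the torus on the polynomial ring covering `A(Γ)`. -/
noncomputable def torusPoly (lam : Γ.V → kˣ) : MvPolynomial Γ.E k →ₐ[k] MvPolynomial Γ.E k :=
  aeval fun e => C ((lam (Γ.s e) : k) * ((lam (Γ.t e))⁻¹ : kˣ)) * X e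

theorem torusPoly_monomial (lam : Γ.V → kˣ) (a : Γ.E →₀ ℕ) (c : k) :
    torusPoly lam (monomial a c) = monomial a (weight lam a * c) := by
  have h1 : torusPoly lam (monomial a c) =
      C c * ∏ e, (C ((lam (Γ.s e) : k) * ((lam (Γ.t e))⁻¹ : kˣ)) * X e) ^ a e := by
    rw [torusPoly, aeval_monomial, algebraMap_eq, Finsupp.prod_fintype _ _ (by simp)]
  have h2 : (monomial a (weight lam a * c) : MvPolynomial Γ.E k) =
      C (weight lam a * c : k) * ∏ e, X e ^ a e := by
    rw [monomial_eq, Finsupp.prod_fintype _ _ (by simp)]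
  rw [h1, h2, weight]
  simp only [mul_pow, Finset.prod_mul_distrib, Units.coe_prod, Units.val_mul,
    Units.val_pow_eq_pow_val, map_mul, map_prod, map_pow]
  ring

theorem coeff_torusPoly (lam : Γ.V → kˣ) (a : Γ.E →₀ ℕ) (f : MvPolynomial Γ.E k) :
    coeff a (torusPoly lam f) = weight lam a * coeff a f := by
  classical
  induction f using MvPolynomial.induction_on' with
  | monomial b c =>
    rw [torusPoly_monomial, coeff_monomial, coeff_monomial]
    split_ifs with h
    · rw [h]
    · simp
  | add f g hf hg => rw [map_add, coeff_add, hf, hg, coeff_add, mul_add]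

theorem torusAct_mk (lam : Γ.V → kˣ) (f : MvPolynomial Γ.E k) :
    Γ.torusAct k lam (Ideal.Quotient.mk _ f) = Ideal.Quotient.mk _ (torusPoly lam f) := rfl

theorem mem_invariants {r : Γ.Aring k} :
    r ∈ Γ.invariants k ↔ ∀ lam : Γ.V → kˣ, Γ.torusAct k lam r = r := by
  simp [invariants, Algebra.mem_iInf, AlgHom.mem_equalizer]

theorem mk_monomial_mem_invariants {a : Γ.E →₀ ℕ} (ha : Balanced a) :
    Ideal.Quotient.mk _ (monomial a (1 : k)) ∈ Γ.invariants k := by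
  rw [mem_invariants]
  intro lam
  rw [torusAct_mk, torusPoly_monomial, ha.weight_eq_one, Units.val_one, one_mul]

theorem balanced_of_coeff_restrict_ne_zero [Infinite k] {S : Set Γ.E}
    (hS : ∀ e ∈ S, Γ.inv e ∉ S) {r : Γ.Aring k} (hr : r ∈ Γ.invariants k) {a : Γ.E →₀ ℕ}
    (ha : coeff a (restrict k S r) ≠ 0) : Balanced a ∧ ∀ e, a e ≠ 0 → e ∈ S := by
  classical
  obtain ⟨f, rfl⟩ := Ideal.Quotient.mk_surjective r
  rw [mem_invariants] at hr
  have haS : ∀ e, a e ≠ 0 → e ∈ S := by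
    by_contra h
    rw [coeff_restrict_mk hS, if_neg h] at ha
    exact ha rfl
  refine ⟨balanced_of_weight_eq_one (k := k) fun lam => ?_, haS⟩
  have h1 := congrArg (fun x => coeff a (restrict k S x)) (hr lam)
  simp only [torusAct_mk, coeff_restrict_mk hS, coeff_torusPoly, if_pos haS] at h1
  rw [coeff_restrict_mk hS, if_pos haS] at ha
  exact Units.ext (mul_right_cancel₀ ha (h1.trans (one_mul _).symm))

/-- The prime ideal of the invariant ring given by the vanishing of the coordinates off `S`. -/
noncomputable def suppPrime (k : Type*) [Field k] (S : Set Γ.E) :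
    PrimeSpectrum (Γ.invariants k) :=
  ⟨RingHom.ker ((restrict k S).comp (Γ.invariants k).val), RingHom.ker_isPrime _⟩

theorem mem_suppPrime {S : Set Γ.E} {r : Γ.invariants k} :
    r ∈ (suppPrime k S).asIdeal ↔ restrict k S r.1 = 0 := Iff.rfl

theorem suppPrime_le_iff {S S' : Set Γ.E} (hS : IsSupp S) (hS' : IsSupp S') :
    suppPrime k S' ≤ suppPrime k S ↔ S ⊆ S' := by
  classical
  constructor
  · intro h
    obtain ⟨a, ha, haS⟩ := hS.exists_balanced
    let b : Γ.E →₀ ℕ := Finsupp.equivFunOnFinite.symm a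
    let r : Γ.invariants k := ⟨_, mk_monomial_mem_invariants (a := b) ha⟩
    by_contra hSS
    have hr : r ∈ (suppPrime k S').asIdeal := by
      rw [mem_suppPrime]
      ext c
      rw [coeff_restrict_mk fun _ => hS'.inv_notMem, coeff_monomial, coeff_zero]
      split_ifs with h1 h2
      · subst h2
        exact absurd (fun e he => h1 e ((haS e).2 he)) hSS
      · rfl
      · rfl
    have := congrArg (coeff b) (mem_suppPrime.1 (h hr))
    rw [coeff_restrict_mk fun _ => hS.inv_notMem, if_pos (fun e he => (haS e).1 he : ∀ e, b e ≠ 0 → e ∈ S)] at this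
    simp at this
  · intro h r hr
    rw [mem_suppPrime] at hr ⊢
    obtain ⟨f, hf⟩ := Ideal.Quotient.mk_surjective r.1
    rw [← hf] at hr ⊢
    ext a
    have := congrArg (coeff a) hr
    rw [coeff_restrict_mk fun _ => hS'.inv_notMem, coeff_zero] at this
    rw [coeff_restrict_mk fun _ => hS.inv_notMem, coeff_zero]
    split_ifs with h1
    · rwa [if_pos fun e he => h (h1 e he)] at this
    · rfl

theorem eq_zero_of_forall_mem_suppPrime [Infinite k] {r : Γ.invariants k}
    (h : ∀ O : Set Γ.E, Maximal IsSupp O → r ∈ (suppPrime k O).asIdeal) : r = 0 := by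
  classical
  refine Subtype.ext (eq_zero_of_restrict_eq_zero fun S hS => ?_)
  ext a
  by_contra ha
  rw [coeff_zero] at ha
  obtain ⟨hbal, haS⟩ := balanced_of_coeff_restrict_ne_zero hS r.2 ha
  obtain ⟨O, hSO, hO⟩ := Finite.exists_le_maximal (p := IsSupp) <| hbal.isSupp fun e he => by
    by_contra he'
    exact hS e (haS e he) (haS _ he')
  have hr := congrArg (coeff a) (mem_suppPrime.1 (h O hO))
  obtain ⟨f, hf⟩ := Ideal.Quotient.mk_surjective r.1
  rw [← hf, coeff_restrict_mk fun _ => hO.1.inv_notMem, if_pos (fun e he => hSO he : ∀ e, a e ≠ 0 → e ∈ O)]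
    at hr
  rw [← hf, coeff_restrict_mk hS, if_pos haS] at ha
  exact ha hr

theorem exists_suppPrime_le [Infinite k] (p : PrimeSpectrum (Γ.invariants k)) :
    ∃ O : Set Γ.E, Maximal IsSupp O ∧ suppPrime k O ≤ p := by
  have hfin := Set.toFinite {O : Set Γ.E | Maximal IsSupp O}
  have hle : hfin.toFinset.inf (fun O => (suppPrime k O).asIdeal) ≤ p.asIdeal := by
    intro r hr
    rw [Submodule.mem_finsetInf] at hr
    rw [eq_zero_of_forall_mem_suppPrime fun O hO => hr O (by simpa using hO)]
    exact p.asIdeal.zero_mem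
  obtain ⟨O, hO, hOp⟩ := (Ideal.IsPrime.inf_le' p.isPrime).1 hle
  exact ⟨O, by simpa using hO, hOp⟩

theorem suppPrime_mem_minimalPrimes [Infinite k] {O : Set Γ.E} (hO : Maximal IsSupp O) :
    (suppPrime k O).asIdeal ∈ minimalPrimes (Γ.invariants k) := by
  refine ⟨⟨(suppPrime k O).isPrime, bot_le⟩, fun q hq hqO => ?_⟩
  obtain ⟨O', hO', hle⟩ := exists_suppPrime_le ⟨q, hq.1⟩
  have h1 : O ⊆ O' := (suppPrime_le_iff hO.1 hO'.1).1 (hle.trans hqO)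
  rwa [← hO.eq_of_subset hO'.1 h1] at hle

theorem card_minimalPrimes_invariants [Infinite k] :
    Nat.card (minimalPrimes (Γ.invariants k)) =
      Nat.card {O : Set Γ.E // Γ.IsTotallyCyclic Γ.Esep O} := by
  symm
  let F : {O : Set Γ.E // Γ.IsTotallyCyclic Γ.Esep O} → minimalPrimes (Γ.invariants k) :=
    fun O => ⟨_, suppPrime_mem_minimalPrimes (k := k) ((isTotallyCyclic_Esep_iff _).1 O.2)⟩
  refine Nat.card_congr (Equiv.ofBijective F ⟨fun O O' h => ?_, fun p => ?_⟩)
  · have hO := (isTotallyCyclic_Esep_iff _).1 O.2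
    have hO' := (isTotallyCyclic_Esep_iff _).1 O'.2
    have h' : (suppPrime k O.1).asIdeal = (suppPrime k O'.1).asIdeal := congrArg Subtype.val h
    exact Subtype.ext (hO.eq_of_subset hO'.1 ((suppPrime_le_iff hO.1 hO'.1).1 h'.ge))
  · obtain ⟨O, hO, hle⟩ := exists_suppPrime_le (k := k) ⟨p.1, p.2.1.1⟩
    refine ⟨⟨O, (isTotallyCyclic_Esep_iff _).2 hO⟩, Subtype.ext ?_⟩
    exact le_antisymm hle (p.2.2 ⟨(suppPrime k O).isPrime, bot_le⟩ hle)

theorem finrank_cyclesOn_le_coheight {S : Set Γ.E} (hS : IsSupp S) :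
    (Module.finrank ℝ (cyclesOn S) : ℕ∞) ≤ Order.coheight (suppPrime k S) := by
  induction S using WellFoundedLT.induction with
  | ind S ih =>
    rcases S.eq_empty_or_nonempty with rfl | hne
    · simp [finrank_cyclesOn_empty]
    · obtain ⟨S', hS', hlt, hle⟩ := hS.exists_facet hne
      have h1 : suppPrime k S < suppPrime k S' := by
        rw [lt_iff_le_not_ge, suppPrime_le_iff hS' hS, suppPrime_le_iff hS hS']
        exact hlt
      calc (Module.finrank ℝ (cyclesOn S) : ℕ∞)
          ≤ Module.finrank ℝ (cyclesOn S') + 1 := by exact_mod_cast hle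
        _ ≤ Order.coheight (suppPrime k S') + 1 := by gcongr; exact ih S' hlt hS'
        _ ≤ _ := Order.coheight_add_one_le h1

theorem restrict_mem_adjoin [Infinite k] {S : Set Γ.E} (hS : ∀ e ∈ S, Γ.inv e ∉ S)
    {r : Γ.Aring k} (hr : r ∈ Γ.invariants k) :
    restrict k S r ∈ Algebra.adjoin k ((fun a => monomial a (1 : k)) ''
      {a : Γ.E →₀ ℕ | Balanced a ∧ ∀ e, a e ≠ 0 → e ∈ S}) := by
  rw [(restrict k S r).as_sum]
  refine Subalgebra.sum_mem _ fun a ha => ?_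
  rw [← mul_one (coeff a _), ← smul_eq_mul, ← smul_monomial]
  refine Subalgebra.smul_mem _ (Algebra.subset_adjoin ?_) _
  exact ⟨a, balanced_of_coeff_restrict_ne_zero hS hr (mem_support_iff.1 ha), rfl⟩

open Classical in
theorem length_le_b1 [Infinite k] (l : LTSeries (PrimeSpectrum (Γ.invariants k))) :
    l.length ≤ Γ.b1 := by
  obtain ⟨O, hO, hle⟩ := exists_suppPrime_le (l 0)
  have hlt : ∀ i : Fin l.length, l i.castSucc < l i.succ := l.step
  have hx : ∀ i : Fin l.length, ∃ x ∈ (l i.succ).asIdeal, x ∉ (l i.castSucc).asIdeal :=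
    fun i => SetLike.exists_of_lt (hlt i)
  choose x hx hx' using hx
  have hy : AlgebraicIndependent k fun i => restrict k O (x i).1 := by
    rw [algebraicIndependent_iff]
    intro F hF
    refine MvPolynomial.eq_zero_of_aeval_mem_of_chain (fun i => (l i).asIdeal)
      (fun i => (l i).isPrime) (fun i => (hlt i).le) x hx hx' F (hle ?_)
    rw [mem_suppPrime, ← hF]
    exact comp_aeval_apply _ ((restrict k O).comp (Γ.invariants k).val) F
  let π : (Γ.E → ℝ) →ₗ[ℝ] (Γ.E → ℝ) :=
    LinearMap.pi fun e => if e ∈ O then LinearMap.proj e else 0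
  have hW : ∀ a ∈ {a : Γ.E →₀ ℕ | Balanced a ∧ ∀ e, a e ≠ 0 → e ∈ O},
      (fun e => ((a e : ℕ) : ℝ)) ∈ (cyclesOn (Set.univ : Set Γ.E)).map π := by
    rintro a ⟨ha, haO⟩
    refine ⟨_, ⟨ha.isCycle, by simp⟩, funext fun e => ?_⟩
    by_cases he : e ∈ O
    · have : a (Γ.inv e) = 0 := by
        by_contra h
        exact hO.1.inv_notMem he (haO _ h)
      simp [π, he, this]
    · have : a e = 0 := by
        by_contra h
        exact he (haO _ h)
      simp [π, he, this]
  rw [b1_eq_finrank_univ]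
  exact (hy.card_le_finrank_of_mem_adjoin_monomial hW fun i =>
    restrict_mem_adjoin (fun _ => hO.1.inv_notMem) (x i).2).trans (Submodule.finrank_map_le π _)

theorem ringKrullDim_invariants [Infinite k] :
    ringKrullDim (Γ.invariants k) = (Γ.b1 : WithBot ℕ∞) := by
  refine le_antisymm (iSup_le fun l => by exact_mod_cast length_le_b1 l) ?_
  obtain ⟨O, -, hO⟩ := Finite.exists_le_maximal (p := IsSupp) (isSupp_empty (Γ := Γ))
  rw [b1_eq_finrank_of_maximal hO]
  calc ((Module.finrank ℝ (cyclesOn O) : ℕ) : WithBot ℕ∞)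
      = ((Module.finrank ℝ (cyclesOn O) : ℕ∞) : WithBot ℕ∞) := rfl
    _ ≤ (Order.coheight (suppPrime k O) : WithBot ℕ∞) := by
      exact_mod_cast finrank_cyclesOn_le_coheight hO.1
    _ ≤ _ := Order.coheight_le_krullDim _

end Invariants

end SerreGraph

/-- Over an infinite field `k`, the invariant subring
`R = A(Γ)^{T_Γ}` is reduced, of Krull dimension `b₁(Γ)`, and its number of
minimal primes equals the number of totally cyclic orientations of `Γ∖E_sep`. -/
theorem stmt19 (k : Type*) [Field k] [Infinite k] (Γ : SerreGraph) :
    IsReduced ↥(Γ.invariants k) ∧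
    ringKrullDim ↥(Γ.invariants k) = (Γ.b1 : WithBot ℕ∞) ∧
    Nat.card ↥(minimalPrimes ↥(Γ.invariants k)) =
      Nat.card {O : Set Γ.E // Γ.IsTotallyCyclic Γ.Esep O} := by
  exact ⟨SerreGraph.isReduced_invariants, SerreGraph.ringKrullDim_invariants,
    SerreGraph.card_minimalPrimes_invariants⟩
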